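/- arXiv:2010.09011 — 2 statements merged into one kernel-verified Lean document; each statement's English description precedes it below -/
import Mathlib

section
/- Let (f_i)_{i=1}^n and (g_j)_{j=1}^n be functions ℤ_{≥-1} → ℝ (extended to ℤ) with g_j decaying superexponentially at +∞, f_i growing at most exponentially, and f_i(-1) = 0 for all i. Then Σ_{x ∈ W^n_{≥0}} det(D^{(1/v_1,...,1/v_j)} f_i(x_j + j - 1))_{i,j=1}^n · det(J^{(v_1,...,v_i)} g_j(x_i + i - 1))_{i,j=1}^n = det( Σ_{u≥0} f_i(u) g_j(u) )_{i,j=1}^n, where W^n_{≥0} = {x ∈ ℤ^n : 0 ≤ x_1 ≤ ... ≤ x_n} and 0 < v_1, ..., v_n. -/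
/-- `(D^{(a)} f)(u) = f u - a * f (u-1)`. -/
noncomputable def Dop (a : ℝ) (f : ℤ → ℝ) : ℤ → ℝ := fun u => f u - a * f (u - 1)

/-- `(J^{(a)} f)(u) = Σ_{j=u}^∞ a^(u-j) f j = Σ_{m : ℕ} a^(-m) f (u+m)`. -/
noncomputable def Jop (a : ℝ) (f : ℤ → ℝ) : ℤ → ℝ := fun u => ∑' m : ℕ, a ^ (-(m : ℤ)) * f (u + m)

/-- Concatenated `D` operators: `DIter [a₁,...,aₖ] = D^{(a₁)} ∘ ... ∘ D^{(aₖ)}`. -/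
noncomputable def DIter (l : List ℝ) (f : ℤ → ℝ) : ℤ → ℝ := l.foldr Dop f

/-- Concatenated `J` operators: `JIter [a₁,...,aₖ] = J^{(a₁)} ∘ ... ∘ J^{(aₖ)}`. -/
noncomputable def JIter (l : List ℝ) (f : ℤ → ℝ) : ℤ → ℝ := l.foldr Jop f

def Decay (ε : ℝ) (h : ℤ → ℝ) : Prop := ∃ C, 0 ≤ C ∧ ∀ u : ℤ, |h u| ≤ C * ε ^ u

noncomputable def Eop (a : ℝ) (h : ℤ → ℝ) : ℤ → ℝ := fun u => h u - a⁻¹ * h (u + 1)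

lemma Decay.shift {ε : ℝ} (hε : 0 < ε) {h : ℤ → ℝ} (hd : Decay ε h) (k : ℤ) :
    Decay ε (fun u => h (u + k)) := by
  obtain ⟨C, hC, hd⟩ := hd
  refine ⟨C * ε ^ k, by positivity, fun u => (hd _).trans (le_of_eq ?_)⟩
  rw [zpow_add₀ hε.ne']; ring

lemma Decay.lin {ε : ℝ} (hε : 0 < ε) {h k : ℤ → ℝ} (hd : Decay ε h) (kd : Decay ε k) (a : ℝ) :
    Decay ε (fun u => h u - a * k u) := by
  obtain ⟨C, hC, hd⟩ := hd
  obtain ⟨D, hD, kd⟩ := kd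
  refine ⟨C + |a| * D, by positivity, fun u => ?_⟩
  calc |h u - a * k u| ≤ |h u| + |a * k u| := abs_sub _ _
    _ ≤ C * ε ^ u + |a| * (D * ε ^ u) := by
      rw [abs_mul]; gcongr
      · exact hd u
      · exact kd u
    _ = _ := by ring

lemma Decay.E {ε : ℝ} (hε : 0 < ε) {h : ℤ → ℝ} (hd : Decay ε h) (a : ℝ) :
    Decay ε (Eop a h) := hd.lin hε (hd.shift hε 1) _

lemma Decay.D {ε : ℝ} (hε : 0 < ε) {h : ℤ → ℝ} (hd : Decay ε h) (a : ℝ) :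
    Decay ε (Dop a h) := hd.lin hε (hd.shift hε (-1)) _

lemma Decay.iterD {ε : ℝ} (hε : 0 < ε) {h : ℤ → ℝ} (hd : Decay ε h) (l : List ℝ) :
    Decay ε (DIter l h) := by
  induction l with
  | nil => exact hd
  | cons a l ih => exact ih.D hε a

lemma Decay.term_le {ε a : ℝ} (hε : 0 < ε) (ha : ε < a) {h : ℤ → ℝ} {C : ℝ}
    (hd : ∀ u : ℤ, |h u| ≤ C * ε ^ u) (u : ℤ) (m : ℕ) :
    |a ^ (-(m : ℤ)) * h (u + m)| ≤ C * ε ^ u * (ε / a) ^ m := by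
  have ha0 : 0 < a := hε.trans ha
  have := hd (u + m)
  rw [abs_mul, abs_of_pos (by positivity : 0 < a ^ (-(m : ℤ)))]
  calc _ ≤ a ^ (-(m : ℤ)) * (C * ε ^ (u + m)) := by gcongr
    _ = _ := by
      rw [zpow_add₀ hε.ne', zpow_neg, zpow_natCast, zpow_natCast, div_pow]
      field_simp

lemma Decay.summable {ε a : ℝ} (hε : 0 < ε) (ha : ε < a) {h : ℤ → ℝ} (hd : Decay ε h) (u : ℤ) :
    Summable (fun m : ℕ => a ^ (-(m : ℤ)) * h (u + m)) := by
  obtain ⟨C, hC, hd⟩ := hd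
  have ha0 : 0 < a := hε.trans ha
  refine Summable.of_norm_bounded
    ((summable_geometric_of_lt_one (by positivity) ((div_lt_one ha0).2 ha)).mul_left (C * ε ^ u))
    fun m => ?_
  exact Decay.term_le hε ha hd u m

lemma Decay.J {ε a : ℝ} (hε : 0 < ε) (ha : ε < a) {h : ℤ → ℝ} (hd : Decay ε h) :
    Decay ε (Jop a h) := by
  obtain ⟨C, hC, hd⟩ := hd
  have ha0 : 0 < a := hε.trans ha
  have hr : ε / a < 1 := (div_lt_one ha0).2 ha
  have hr' : 0 < 1 - ε / a := by linarith
  refine ⟨C * (1 - ε / a)⁻¹, by positivity, fun u => ?_⟩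
  have hs := (hasSum_geometric_of_lt_one (by positivity) hr).mul_left (C * ε ^ u)
  have := tsum_of_norm_bounded hs (f := fun m : ℕ => a ^ (-(m : ℤ)) * h (u + m))
    (fun m => Decay.term_le hε ha hd u m)
  rw [Real.norm_eq_abs] at this
  unfold Jop
  linarith

lemma Decay.iterJ {ε : ℝ} (hε : 0 < ε) {h : ℤ → ℝ} (hd : Decay ε h) (l : List ℝ)
    (hl : ∀ a ∈ l, ε < a) : Decay ε (JIter l h) := by
  induction l with
  | nil => exact hd
  | cons a l ih =>
    exact Decay.J hε (hl a (by simp)) (ih fun b hb => hl b (by simp [hb]))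

lemma E_Jop_self {ε a : ℝ} (hε : 0 < ε) (ha : ε < a) {h : ℤ → ℝ} (hd : Decay ε h) :
    Eop a (Jop a h) = h := by
  have ha0 : 0 < a := hε.trans ha
  funext u
  unfold Eop Jop
  rw [(hd.summable hε ha u).tsum_eq_zero_add, ← tsum_mul_left]
  have : ∀ m : ℕ, a ^ (-((m + 1 : ℕ) : ℤ)) * h (u + (m + 1 : ℕ))
      = a⁻¹ * (a ^ (-(m : ℤ)) * h (u + 1 + m)) := by
    intro m
    have e : u + ((m + 1 : ℕ) : ℤ) = u + 1 + m := by push_cast; ring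
    rw [e, zpow_neg, zpow_neg, zpow_natCast, zpow_natCast, pow_succ, mul_inv]; ring
  simp only [this]
  simp

lemma E_Jop {ε a b : ℝ} (hε : 0 < ε) (hb : ε < b) {h : ℤ → ℝ} (hd : Decay ε h) :
    Eop a (Jop b h) = Jop b (Eop a h) := by
  funext u
  unfold Eop Jop
  rw [← tsum_mul_left, ← (hd.summable hε hb u).tsum_sub ((hd.summable hε hb (u+1)).mul_left _)]
  refine tsum_congr fun m => ?_
  rw [show u + 1 + (m : ℤ) = u + m + 1 by ring]; ring

lemma E_JIter {ε a : ℝ} (hε : 0 < ε) {h : ℤ → ℝ} (hd : Decay ε h) (l : List ℝ)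
    (hl : ∀ a ∈ l, ε < a) : Eop a (JIter l h) = JIter l (Eop a h) := by
  induction l with
  | nil => rfl
  | cons b l ih =>
    have hl' : ∀ a ∈ l, ε < a := fun c hc => hl c (by simp [hc])
    have := ih hl'
    show Eop a (Jop b (JIter l h)) = Jop b (JIter l (Eop a h))
    rw [E_Jop hε (hl b (by simp)) (hd.iterJ hε l hl'), this]

lemma JIter_snoc {ε a : ℝ} (hε : 0 < ε) (ha : ε < a) {h : ℤ → ℝ} (hd : Decay ε h) (l : List ℝ)
    (hl : ∀ a ∈ l, ε < a) : Eop a (JIter (l ++ [a]) h) = JIter l h := by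
  have : JIter (l ++ [a]) h = JIter l (Jop a h) := by simp [JIter]
  rw [this, E_JIter hε (hd.J hε ha) l hl, E_Jop_self hε ha hd]

lemma Dop_comm (a b : ℝ) (h : ℤ → ℝ) : Dop a (Dop b h) = Dop b (Dop a h) := by
  funext u; unfold Dop; ring

lemma DIter_snoc (a : ℝ) (h : ℤ → ℝ) (l : List ℝ) : DIter (l ++ [a]) h = Dop a (DIter l h) := by
  induction l with
  | nil => rfl
  | cons b l ih =>
    show Dop b (DIter (l ++ [a]) h) = Dop a (Dop b (DIter l h))
    rw [ih, Dop_comm]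

lemma DIter_neg (h : ℤ → ℝ) (hh : ∀ u < 0, h u = 0) (l : List ℝ) : ∀ u < 0, DIter l h u = 0 := by
  induction l with
  | nil => exact hh
  | cons b l ih =>
    intro u hu
    show DIter l h u - b * DIter l h (u - 1) = 0
    rw [ih u hu, ih (u-1) (by omega)]; simp

lemma DIter_congr (h k : ℤ → ℝ) (hh : ∀ u ≥ -1, h u = k u) (l : List ℝ) :
    ∀ u : ℤ, (l.length : ℤ) - 1 ≤ u → DIter l h u = DIter l k u := by
  induction l with
  | nil => intro u hu; exact hh u (by simpa using hu)
  | cons b l ih =>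
    intro u hu
    simp only [List.length_cons] at hu
    push_cast at hu
    show DIter l h u - b * DIter l h (u - 1) = DIter l k u - b * DIter l k (u - 1)
    rw [ih u (by omega), ih (u-1) (by omega)]

lemma JIter_congr (h k : ℤ → ℝ) (hh : ∀ u ≥ 0, h u = k u) (l : List ℝ) :
    ∀ u : ℤ, 0 ≤ u → JIter l h u = JIter l k u := by
  induction l with
  | nil => intro u hu; exact hh u hu
  | cons b l ih =>
    intro u hu
    show Jop b (JIter l h) u = Jop b (JIter l k) u
    unfold Jop
    exact tsum_congr fun m => by rw [ih (u + m) (by omega)]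

lemma pi_prod (n : ℕ) (h : Fin n → ℤ → ℝ) (hs : ∀ i, Summable (h i)) :
    HasSum (fun y : Fin n → ℤ => ∏ i, h i (y i)) (∏ i, ∑' u, h i u) := by
  induction n with
  | zero => simp
  | succ n ih =>
    have h1 := ih (fun i => h i.succ) (fun i => hs _)
    have h0 := (hs 0).hasSum
    have h3 : Summable (fun x : ℤ × (Fin n → ℤ) => h 0 x.1 * ∏ i, h (Fin.succ i) (x.2 i)) :=
      summable_mul_of_summable_norm (f := h 0) (g := fun y : Fin n → ℤ => ∏ i, h (Fin.succ i) (y i))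
        (hs 0).norm h1.summable.norm
    have h2 := HasSum.mul h0 h1 h3
    rw [← (Fin.consEquiv (fun _ => ℤ)).hasSum_iff, Fin.prod_univ_succ]
    have h4 : ((fun y : Fin (n + 1) → ℤ => ∏ i, h i (y i)) ∘ (Fin.consEquiv (fun _ => ℤ))) =
        fun x : ℤ × (Fin n → ℤ) => h 0 x.1 * ∏ i, h (Fin.succ i) (x.2 i) := by
      funext x
      simp [Fin.consEquiv, Fin.prod_univ_succ]
    rw [h4]
    exact h2

/-- Admissible pairs. -/
def Grow (R : ℝ) (h : ℤ → ℝ) : Prop := Decay R h ∧ ∀ u < 0, h u = 0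

lemma Grow.summable {R ε : ℝ} (hR : 0 < R) (hε : 0 < ε) (hRε : R * ε < 1) {h k : ℤ → ℝ}
    (hh : Grow R h) (hk : Decay ε k) : Summable (fun u => h u * k u) := by
  obtain ⟨⟨C, hC, hd⟩, h0⟩ := hh
  obtain ⟨D, hD, kd⟩ := hk
  have hinj : Function.Injective (fun n : ℕ => (n : ℤ)) := Nat.cast_injective
  rw [← hinj.summable_iff]
  · refine Summable.of_norm_bounded
      ((summable_geometric_of_lt_one (by positivity) hRε).mul_left (C * D)) fun m => ?_
    have h1 := hd m
    have h2 := kd m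
    simp only [zpow_natCast] at h1 h2
    simp only [Function.comp, Real.norm_eq_abs, abs_mul]
    calc _ ≤ (C * R ^ m) * (D * ε ^ m) := by gcongr
      _ = _ := by rw [mul_pow]; ring
  · intro u hu
    rw [h0 u, zero_mul]
    by_contra hc
    exact hu ⟨u.toNat, by simp; omega⟩

/-- Determinant with column functions `A j`. -/
noncomputable def MM {n : ℕ} (A : Fin n → Fin n → ℤ → ℝ) (y : Fin n → ℤ) : ℝ :=
  Matrix.det (Matrix.of fun i j : Fin n => A j i (y j))

lemma MM_summable {n : ℕ} {R ε : ℝ} (hR : 0 < R) (hε : 0 < ε) (hRε : R * ε < 1)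
    (A B : Fin n → Fin n → ℤ → ℝ) (hA : ∀ j i, Grow R (A j i)) (hB : ∀ j i, Decay ε (B j i)) :
    Summable (fun y => MM A y * MM B y) := by
  have : (fun y => MM A y * MM B y) = fun y => ∑ σ : Equiv.Perm (Fin n), ∑ τ : Equiv.Perm (Fin n),
      ((((Equiv.Perm.sign σ : ℤ) : ℝ) * ((Equiv.Perm.sign τ : ℤ) : ℝ)) *
        ∏ j, (A j (σ j) (y j) * B j (τ j) (y j))) := by
    funext y
    unfold MM
    rw [Matrix.det_apply', Matrix.det_apply', Finset.sum_mul_sum]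
    refine Finset.sum_congr rfl fun σ _ => Finset.sum_congr rfl fun τ _ => ?_
    simp only [Matrix.of_apply, Finset.prod_mul_distrib]
    ring
  rw [this]
  refine summable_sum fun σ _ => summable_sum fun τ _ => Summable.mul_left _ ?_
  exact (pi_prod n (fun j u => A j (σ j) u * B j (τ j) u)
    fun j => (hA _ _).summable hR hε hRε (hB _ _)).summable

lemma MM_eq_zero {n : ℕ} (A : Fin n → Fin n → ℤ → ℝ) (y : Fin n → ℤ) (p q : Fin n) (hpq : p ≠ q)
    (hA : A p = A q) (hy : y p = y q) : MM A y = 0 := by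
  unfold MM
  exact Matrix.det_zero_of_column_eq hpq (fun i => by simp [hA, hy])

lemma MM_neg {n : ℕ} (A : Fin n → Fin n → ℤ → ℝ) (y : Fin n → ℤ) (p : Fin n)
    (hA : ∀ i, ∀ u < 0, A p i u = 0) (hy : y p < 0) : MM A y = 0 := by
  unfold MM
  exact Matrix.det_eq_zero_of_column_eq_zero p (fun i => by simp [hA i _ hy])

lemma MM_update {n : ℕ} (A : Fin n → Fin n → ℤ → ℝ) (y : Fin n → ℤ) (p : Fin n)
    (F : Fin n → ℤ → ℝ) :
    MM (Function.update A p F) y =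
      Matrix.det (Matrix.updateCol (Matrix.of fun i j : Fin n => A j i (y j)) p
        (fun i => F i (y p))) := by
  unfold MM
  congr 1
  ext i j
  by_cases h : j = p
  · subst h; simp
  · simp [h]

lemma MM_lin {n : ℕ} (A : Fin n → Fin n → ℤ → ℝ) (y : Fin n → ℤ) (p : Fin n)
    (F G : Fin n → ℤ → ℝ) (a : ℝ) :
    MM (Function.update A p (fun i u => F i u - a * G i u)) y =
      MM (Function.update A p F) y - a * MM (Function.update A p G) y := by
  simp only [MM_update]
  have : (fun i => F i (y p) - a * G i (y p)) =
    (fun i => F i (y p)) + (-a) • (fun i => G i (y p)) := by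
      funext i; simp; ring
  rw [this, Matrix.det_updateCol_add, Matrix.det_updateCol_smul]; ring

lemma MM_shift {n : ℕ} (A : Fin n → Fin n → ℤ → ℝ) (y : Fin n → ℤ) (p : Fin n)
    (F : Fin n → ℤ → ℝ) (k : ℤ) :
    MM (Function.update A p (fun i u => F i (u + k))) y =
      MM (Function.update A p F) (y + Pi.single p k) := by
  unfold MM
  congr 1
  ext i j
  by_cases h : j = p
  · subst h; simp
  · simp [h]

lemma strict_iff {n : ℕ} (y : Fin n → ℤ) :
    StrictMono y ↔ ∀ i j : Fin n, (i : ℕ) + 1 = j → y i < y j := by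
  constructor
  · intro h i j hij
    exact h (Fin.lt_def.2 (by omega))
  · intro h
    cases n with
    | zero => intro i; exact i.elim0
    | succ n =>
      rw [Fin.strictMono_iff_lt_succ]
      intro i; exact h _ _ (by simp)

lemma mono_iff {n : ℕ} (y : Fin n → ℤ) :
    Monotone y ↔ ∀ i j : Fin n, (i : ℕ) + 1 = j → y i ≤ y j := by
  constructor
  · intro h i j hij
    exact h (Fin.le_def.2 (by omega))
  · intro h
    cases n with
    | zero => intro i; exact i.elim0
    | succ n =>
      rw [Fin.monotone_iff_le_succ]
      intro i; exact h _ _ (by simp)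

open Classical in
/-- Sum over strictly increasing tuples. -/
noncomputable def SS {n : ℕ} (P : (Fin n → ℤ) → ℝ) : ℝ :=
  ∑' y : Fin n → ℤ, if StrictMono y then P y else 0

lemma step {n : ℕ} {R ε : ℝ} (hR : 0 < R) (hε : 0 < ε) (hRε : R * ε < 1)
    (A B : Fin n → Fin n → ℤ → ℝ) (hA : ∀ j i, Grow R (A j i)) (hB : ∀ j i, Decay ε (B j i))
    (p : Fin n) (F H : Fin n → ℤ → ℝ) (hF : ∀ i, Grow R (F i)) (hH : ∀ i, Decay ε (H i)) (a : ℝ)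
    (hlo : ∀ q : Fin n, (q : ℕ) + 1 = p → A q = F) (hhi : ∀ q : Fin n, (p : ℕ) + 1 = q → B q = H) :
    SS (fun y => MM (Function.update A p (fun i => Dop a⁻¹ (F i))) y *
        MM (Function.update B p H) y) =
    SS (fun y => MM (Function.update A p F) y *
        MM (Function.update B p (fun i => Eop a (H i))) y) := by
  classical
  set A' := Function.update A p F with hA'
  set B' := Function.update B p H with hB'
  set B'' := Function.update B p (fun i => Eop a (H i)) with hB''
  set Bs := Function.update B p (fun i u => H i (u + 1)) with hBs
  have gA' : ∀ j i, Grow R (A' j i) := by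
    intro j i; by_cases h : j = p
    · subst h; simpa [hA'] using hF i
    · simpa [hA', h] using hA j i
  have gB'' : ∀ j i, Decay ε (B'' j i) := by
    intro j i; by_cases h : j = p
    · subst h; simpa [hB''] using (hH i).E hε a
    · simpa [hB'', h] using hB j i
  have gBs : ∀ j i, Decay ε (Bs j i) := by
    intro j i; by_cases h : j = p
    · subst h; simpa [hBs] using (hH i).shift hε 1
    · simpa [hBs, h] using hB j i
  set e : Fin n → ℤ := Pi.single p 1 with he
  set T : (Fin n → ℤ) → ℝ := fun y => MM A' y * MM Bs y with hT
  have sT : Summable T := MM_summable hR hε hRε _ _ gA' gBs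
  have sP : Summable (fun y => MM A' y * MM B'' y) := MM_summable hR hε hRε _ _ gA' gB''
  have ind_s : ∀ {P : (Fin n → ℤ) → ℝ}, Summable P →
      Summable (fun y => if StrictMono y then P y else 0) := by
    intro P hP
    refine Summable.of_norm_bounded hP.norm fun y => ?_
    split_ifs <;> simp
  have eBs : ∀ y, MM Bs y = MM B' (y + e) := fun y => MM_shift B y p H 1
  have key : ∀ y, (if StrictMono y then T y else 0) = if StrictMono (y + e) then T y else 0 := by
    intro y
    have hyp : (y + e) p = y p + 1 := by simp [he]
    have hyq : ∀ q, q ≠ p → (y + e) q = y q := by intro q hq; simp [he, hq]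
    by_cases h1 : StrictMono y <;> by_cases h2 : StrictMono (y + e)
    · simp [h1, h2]
    · simp only [h1, h2, if_true, if_false]
      rw [strict_iff] at h1 h2
      push Not at h2
      obtain ⟨i, j, hij, hle⟩ := h2
      have hne : i ≠ j := by rintro rfl; omega
      have h3 := h1 i j hij
      by_cases hi : i = p
      · subst hi
        rw [hyp, hyq j hne.symm] at hle
        have : MM B' (y + e) = 0 := by
          refine MM_eq_zero _ _ i j hne ?_ ?_
          · simp [hB', hne.symm, hhi j hij]
          · rw [hyp, hyq j hne.symm]; omega
        simp only [hT, eBs, this, mul_zero]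
      · rw [hyq i hi] at hle
        by_cases hj : j = p
        · subst hj; rw [hyp] at hle; omega
        · rw [hyq j hj] at hle; omega
    · simp only [h1, h2, if_true, if_false]
      rw [strict_iff] at h1 h2
      push Not at h1
      obtain ⟨i, j, hij, hle⟩ := h1
      have hne : i ≠ j := by rintro rfl; omega
      have h3 := h2 i j hij
      by_cases hj : j = p
      · subst hj
        rw [hyp, hyq i hne] at h3
        have : MM A' y = 0 := by
          refine MM_eq_zero _ _ i j hne ?_ ?_
          · simp [hA', hne, hlo i hij]
          · omega
        simp only [hT, this, zero_mul]
      · rw [hyq j hj] at h3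
        by_cases hi : i = p
        · subst hi; rw [hyp] at h3; omega
        · rw [hyq i hi] at h3; omega
    · simp [h1, h2]
  have pw : ∀ y, MM (Function.update A p (fun i => Dop a⁻¹ (F i))) y * MM B' y =
      MM A' y * MM B'' y + a⁻¹ * (T y - T (y - e)) := by
    intro y
    have e1 : MM (Function.update A p (fun i => Dop a⁻¹ (F i))) y =
        MM A' y - a⁻¹ * MM A' (y - e) := by
      have := MM_lin A y p F (fun i u => F i (u + (-1))) a⁻¹
      rw [MM_shift] at this
      have e0 : y + Pi.single p (-1) = y - e := by
        rw [he, sub_eq_add_neg, Pi.single_neg]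
      rw [e0] at this
      exact this
    have e2 : MM B'' y = MM B' y - a⁻¹ * MM Bs y := MM_lin B y p H (fun i u => H i (u + 1)) a⁻¹
    simp only [hT]
    rw [e1, e2, eBs (y - e), sub_add_cancel]
    ring
  have sT1 := ind_s sT
  have hs : HasSum (fun y => if StrictMono y then T y else 0)
      (∑' y, if StrictMono y then T y else 0) := sT1.hasSum
  have hs2 : HasSum (fun y => if StrictMono y then T (y - e) else 0)
      (∑' y, if StrictMono y then T y else 0) := by
    rw [← (Equiv.addRight e).hasSum_iff]
    convert hs using 1
    funext y
    simp only [Function.comp, Equiv.coe_addRight, add_sub_cancel_right]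
    exact (key y).symm
  have hs3 := (ind_s sP).hasSum.add ((hs.sub hs2).mul_left a⁻¹)
  unfold SS
  simp only [sub_self, mul_zero, add_zero] at hs3
  rw [← hs3.tsum_eq]
  refine tsum_congr fun y => ?_
  split_ifs
  · exact pw y
  · simp

lemma cauchy_binet {n : ℕ} {R ε : ℝ} (hR : 0 < R) (hε : 0 < ε) (hRε : R * ε < 1)
    (F G : Fin n → ℤ → ℝ) (hF : ∀ i, Grow R (F i)) (hG : ∀ i, Decay ε (G i)) :
    SS (fun y => MM (fun _ => F) y * MM (fun _ => G) y) =
      Matrix.det (Matrix.of fun i j : Fin n => ∑' u, F i u * G j u) := by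
  classical
  have sFG : ∀ i j, Summable (fun u => F i u * G j u) := fun i j => (hF i).summable hR hε hRε (hG j)
  set K : (Fin n → ℤ) → ℝ := fun y => MM (fun _ => F) y * ∏ j, G j (y j) with hK
  have hK1 : HasSum K (Matrix.det (Matrix.of fun i j : Fin n => ∑' u, F i u * G j u)) := by
    rw [Matrix.det_apply']
    have : K = fun y => ∑ τ : Equiv.Perm (Fin n), ((Equiv.Perm.sign τ : ℤ) : ℝ) *
        ∏ j, (F (τ j) (y j) * G j (y j)) := by
      funext y
      simp only [hK, MM]
      rw [Matrix.det_apply', Finset.sum_mul]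
      refine Finset.sum_congr rfl fun τ _ => ?_
      simp only [Matrix.of_apply, Finset.prod_mul_distrib]
      ring
    rw [this]
    refine hasSum_sum fun τ _ => HasSum.mul_left _ ?_
    exact pi_prod n (fun j u => F (τ j) u * G j u) fun j => sFG _ _
  have hperm : ∀ (σ : Equiv.Perm (Fin n)) y, MM (fun _ => F) (y ∘ σ) =
      ((Equiv.Perm.sign σ : ℤ) : ℝ) * MM (fun _ => F) y := by
    intro σ y
    unfold MM
    rw [← Matrix.det_permute']
    rfl
  have hsq : ∀ σ : Equiv.Perm (Fin n),
      ((Equiv.Perm.sign σ : ℤ) : ℝ) * ((Equiv.Perm.sign σ : ℤ) : ℝ) = 1 := by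
    intro σ
    rcases Int.units_eq_one_or (Equiv.Perm.sign σ) with h | h <;> simp [h]
  have hPQ : ∀ y, MM (fun _ => F) y * MM (fun _ => G) y = ∑ σ : Equiv.Perm (Fin n), K (y ∘ σ) := by
    intro y
    have : MM (fun _ => G) y = ∑ σ : Equiv.Perm (Fin n), ((Equiv.Perm.sign σ : ℤ) : ℝ) *
        ∏ j, G j (y (σ j)) := by
      unfold MM
      rw [← Matrix.det_transpose, Matrix.det_apply']
      rfl
    rw [this, Finset.mul_sum]
    refine Finset.sum_congr rfl fun σ _ => ?_
    simp only [hK, hperm, Function.comp]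
    ring
  have hcount : ∀ y, K y = ∑ σ : Equiv.Perm (Fin n), if StrictMono (y ∘ σ.symm) then K y else 0 := by
    intro y
    by_cases hy : Function.Injective y
    · rw [Finset.sum_eq_single (Tuple.sort y).symm]
      · rw [if_pos]
        exact (Tuple.monotone_sort y).strictMono_of_injective (hy.comp (Equiv.injective _))
      · intro σ _ hσ
        rw [if_neg]
        intro hm
        apply hσ
        have h1 := Tuple.unique_monotone hm.monotone (Tuple.monotone_sort y)
        have h2 : σ.symm = Tuple.sort y := by
          ext1 i
          exact hy (congrFun h1 i)
        rw [← h2]; simp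
      · simp
    · have : K y = 0 := by
        simp only [Function.Injective] at hy
        push Not at hy
        obtain ⟨i, j, hij, hne⟩ := hy
        simp only [hK]
        rw [MM_eq_zero _ y i j hne rfl hij, zero_mul]
      simp [this]
  have ind_s : ∀ σ : Equiv.Perm (Fin n),
      Summable (fun y => if StrictMono (y ∘ σ.symm) then K y else 0) := by
    intro σ
    refine Summable.of_norm_bounded hK1.summable.norm fun y => ?_
    split_ifs <;> simp
  have hre : ∀ σ : Equiv.Perm (Fin n),
      HasSum (fun y => if StrictMono y then K (y ∘ σ) else 0)
        (∑' y, if StrictMono (y ∘ σ.symm) then K y else 0) := by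
    intro σ
    have := (ind_s σ).hasSum
    rw [← (Equiv.arrowCongr σ.symm (Equiv.refl ℤ)).hasSum_iff] at this
    convert this using 1
    funext y
    have e1 : (Equiv.arrowCongr σ.symm (Equiv.refl ℤ)) y = y ∘ σ := by
      funext i; simp [Equiv.arrowCongr]
    have e2 : (y ∘ σ) ∘ σ.symm = y := by funext i; simp
    simp only [Function.comp_apply, e1, e2]
  rw [← hK1.tsum_eq]
  have h3 : HasSum (fun y => ∑ σ : Equiv.Perm (Fin n), if StrictMono y then K (y ∘ σ) else 0) _ :=
    hasSum_sum fun σ _ => hre σ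
  have h4 : HasSum (fun y => ∑ σ : Equiv.Perm (Fin n), if StrictMono (y ∘ σ.symm) then K y else 0) _ :=
    hasSum_sum fun σ _ => (ind_s σ).hasSum
  calc SS _ = ∑' y, ∑ σ : Equiv.Perm (Fin n), if StrictMono y then K (y ∘ σ) else 0 := by
        unfold SS
        refine tsum_congr fun y => ?_
        split_ifs
        · exact hPQ y
        · simp
    _ = ∑' y, ∑ σ : Equiv.Perm (Fin n), if StrictMono (y ∘ σ.symm) then K y else 0 := by
        rw [h3.tsum_eq, h4.tsum_eq]
    _ = _ := tsum_congr fun y => (hcount y).symm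

lemma MM_congr {n : ℕ} (A B : Fin n → Fin n → ℤ → ℝ) (y : Fin n → ℤ)
    (h : ∀ i j, A j i (y j) = B j i (y j)) : MM A y = MM B y := by
  unfold MM
  congr 1
  ext i j
  exact h i j

/-- The sum with levels `L`. -/
noncomputable def Lev {n : ℕ} (v : ℕ → ℝ) (f g : Fin n → ℤ → ℝ) (L : ℕ → ℕ) : ℝ :=
  SS (fun y => MM (fun (j : Fin n) i => DIter ((List.range (L j)).map fun k => (v k)⁻¹) (f i)) y *
    MM (fun (j : Fin n) i => JIter ((List.range (L j)).map v) (g i)) y)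

lemma Lev_congr {n : ℕ} (v : ℕ → ℝ) (f g : Fin n → ℤ → ℝ) (L L' : ℕ → ℕ)
    (h : ∀ j < n, L j = L' j) : Lev v f g L = Lev v f g L' := by
  have : (fun j : Fin n => L j) = fun j : Fin n => L' j := funext fun j => h j j.2
  have h' : ∀ j : Fin n, L j = L' j := fun j => h j j.2
  unfold Lev
  simp only [h']

lemma Lev_step {n : ℕ} {R ε : ℝ} (hR : 0 < R) (hε : 0 < ε) (hRε : R * ε < 1) (v : ℕ → ℝ)
    (hv : ∀ i < n, ε < v i) (f g : Fin n → ℤ → ℝ) (hf : ∀ i, Grow R (f i))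
    (hg : ∀ i, Decay ε (g i)) (L : ℕ → ℕ) (hL : ∀ j < n, L j ≤ n) (p k : ℕ) (hp : p < n)
    (hpk : L p = k + 1)
    (hlo : ∀ q, q + 1 = p → L q = k) (hhi : p + 1 < n → L (p + 1) = k + 1) :
    Lev v f g L = Lev v f g (Function.update L p k) := by
  have hk : k < n := by have := hL p hp; omega
  have hmem : ∀ m ≤ n, ∀ a ∈ (List.range m).map v, ε < a := by
    intro m hm a ha
    simp only [List.mem_map, List.mem_range] at ha
    obtain ⟨i, hi, rfl⟩ := ha
    exact hv i (by omega)
  set A : Fin n → Fin n → ℤ → ℝ :=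
    fun j i => DIter ((List.range (L j)).map fun k => (v k)⁻¹) (f i) with hA
  set B : Fin n → Fin n → ℤ → ℝ := fun j i => JIter ((List.range (L j)).map v) (g i) with hB
  have gD : ∀ m i, Grow R (DIter ((List.range m).map fun k => (v k)⁻¹) (f i)) :=
    fun m i => ⟨(hf i).1.iterD hR _, DIter_neg _ (hf i).2 _⟩
  have gJ : ∀ m ≤ n, ∀ i, Decay ε (JIter ((List.range m).map v) (g i)) :=
    fun m hm i => (hg i).iterJ hε _ (hmem m hm)
  have := step hR hε hRε A B (fun j i => gD _ i) (fun j i => gJ _ (hL j j.2) i) ⟨p, hp⟩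
    (fun i => DIter ((List.range k).map fun k => (v k)⁻¹) (f i))
    (fun i => JIter ((List.range (k + 1)).map v) (g i)) (fun i => gD _ i)
    (fun i => gJ _ (by omega) i) (v k)
    (by
      intro q hq
      funext i
      simp only [hA]
      rw [hlo q hq])
    (by
      intro q hq
      funext i
      simp only [hB]
      have hq' : p + 1 = q := hq
      rw [← hq', hhi (by omega)])
  have e1 : Function.update A ⟨p, hp⟩ (fun i => Dop (v k)⁻¹
      (DIter ((List.range k).map fun k => (v k)⁻¹) (f i))) = A := by
    rw [Function.update_eq_self_iff]
    funext i
    simp only [hA, hpk, List.range_succ, List.map_append, List.map_cons, List.map_nil]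
    rw [DIter_snoc]
  have e2 : Function.update B ⟨p, hp⟩ (fun i => JIter ((List.range (k + 1)).map v) (g i)) = B := by
    rw [Function.update_eq_self_iff]
    funext i
    simp only [hB, hpk]
  have e3 : Function.update A ⟨p, hp⟩
      (fun i => DIter ((List.range k).map fun k => (v k)⁻¹) (f i)) =
      fun (j : Fin n) i =>
        DIter ((List.range (Function.update L p k j)).map fun k => (v k)⁻¹) (f i) := by
    funext j i
    by_cases h : j = ⟨p, hp⟩
    · subst h; simp
    · have h' : (j : ℕ) ≠ p := fun hh => h (Fin.ext hh)
      simp [h, h', hA]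
  have e4 : Function.update B ⟨p, hp⟩
      (fun i => Eop (v k) (JIter ((List.range (k + 1)).map v) (g i))) =
      fun (j : Fin n) i => JIter ((List.range (Function.update L p k j)).map v) (g i) := by
    funext j i
    by_cases h : j = ⟨p, hp⟩
    · subst h
      simp only [Function.update_self, List.range_succ, List.map_append, List.map_cons,
        List.map_nil]
      rw [JIter_snoc hε (hv k hk) (hg i) _ (hmem k hk.le)]
    · have h' : (j : ℕ) ≠ p := fun hh => h (Fin.ext hh)
      simp [h, h', hB]
  rw [e1, e2, e3, e4] at this
  exact this

lemma Lev_all {n : ℕ} {R ε : ℝ} (hR : 0 < R) (hε : 0 < ε) (hRε : R * ε < 1) (v : ℕ → ℝ)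
    (hv : ∀ i < n, ε < v i) (f g : Fin n → ℤ → ℝ) (hf : ∀ i, Grow R (f i))
    (hg : ∀ i, Decay ε (g i)) :
    Lev v f g (fun j => j + 1) = Lev v f g (fun _ => 0) := by
  have inner : ∀ m, ∀ q ≤ n, Lev v f g (fun j => min (j + 1) (m + 1)) =
      Lev v f g (fun j => if j < q then min (j + 1) m else min (j + 1) (m + 1)) := by
    intro m q
    induction q with
    | zero => intro _; simp
    | succ q ih =>
      intro hq
      rw [ih (by omega)]
      by_cases hqm : q < m
      · refine Lev_congr _ _ _ _ _ fun j hj => ?_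
        try dsimp only
        split_ifs <;> omega
      · rw [Lev_step hR hε hRε v hv f g hf hg _ _ q m (by omega)]
        · refine Lev_congr _ _ _ _ _ fun j hj => ?_
          by_cases hjq : j = q
          · subst hjq; simp; omega
          · simp only [Function.update_of_ne hjq]
            split_ifs <;> omega
        · try dsimp only
          split_ifs <;> omega
        · intro r hr
          try dsimp only
          split_ifs <;> omega
        · intro _
          try dsimp only
          split_ifs <;> omega
        · intro j hj
          try dsimp only
          split_ifs <;> omega
  have outer : ∀ m, Lev v f g (fun j => min (j + 1) m) = Lev v f g (fun _ => 0) := by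
    intro m
    induction m with
    | zero => simp
    | succ m ih =>
      rw [inner m n le_rfl, ← ih]
      exact Lev_congr _ _ _ _ _ fun j hj => by simp [hj]
  rw [← outer n]
  exact Lev_congr _ _ _ _ _ fun j hj => by omega

lemma exists_eps (n : ℕ) (v : ℕ → ℝ) (hv : ∀ i < n, 0 < v i) (R : ℝ) (hR : 0 < R) :
    ∃ ε, 0 < ε ∧ ε ≤ 1 ∧ R * ε < 1 ∧ ∀ i < n, ε < v i := by
  induction n with
  | zero =>
    refine ⟨min 1 (R⁻¹ / 2), by positivity, min_le_left _ _, ?_, by simp⟩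
    calc R * min 1 (R⁻¹ / 2) ≤ R * (R⁻¹ / 2) := by gcongr; exact min_le_right _ _
      _ = 1 / 2 := by field_simp
      _ < 1 := by norm_num
  | succ n ih =>
    obtain ⟨ε, h0, h1, h2, h3⟩ := ih fun i hi => hv i (by omega)
    have hvn := hv n (by omega)
    have hle : min ε (v n / 2) ≤ ε := min_le_left _ _
    refine ⟨min ε (v n / 2), by positivity, hle.trans h1, ?_, ?_⟩
    · calc R * min ε (v n / 2) ≤ R * ε := by gcongr
        _ < 1 := h2
    · intro i hi
      rcases Nat.lt_succ_iff_lt_or_eq.1 hi with h | h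
      · exact hle.trans_lt (h3 i h)
      · subst h
        exact (min_le_right _ _).trans_lt (by linarith)

lemma trunc_decay {ε C : ℝ} (hC : 0 ≤ C) (hε : 0 < ε) (h : ℤ → ℝ)
    (hh : ∀ u : ℕ, |h (u : ℤ)| ≤ C * ε ^ u) : Decay ε (fun u => if u < 0 then 0 else h u) := by
  refine ⟨C, hC, fun u => ?_⟩
  dsimp only
  split_ifs with hu
  · simp only [abs_zero]; positivity
  · obtain ⟨m, rfl⟩ := Int.eq_ofNat_of_zero_le (not_lt.1 hu)
    simpa using hh m

/-- The determinantal summation identity over `W^n_{≥0} = {0 ≤ x 1 ≤ ... ≤ x n}`: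
with `f i (-1) = 0`, `f i` of at most exponential growth and `g j` superexponentially
decaying at `+∞`,
`Σ_{x ∈ W^n_{≥0}} det(D^{(1/v_1,...,1/v_j)} f_i(x_j + j - 1)) det(J^{(v_1,...,v_i)} g_j(x_i + i - 1))
  = det(Σ_{u ≥ 0} f_i(u) g_j(u))`.
Here `v : ℕ → ℝ` lists the parameters `v_1 = v 0, ..., v_n = v (n-1)`, and indices of rows and
columns are 0-based (so the argument `x_j + j - 1` becomes `x j + j`). -/
theorem stmt5 (n : ℕ) (v : ℕ → ℝ) (hv : ∀ i < n, 0 < v i)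
    (f g : Fin n → ℤ → ℝ)
    (hf0 : ∀ i, f i (-1) = 0)
    (hf : ∃ C R : ℝ, 0 < C ∧ 0 < R ∧ ∀ i, ∀ u : ℕ, |f i (u : ℤ)| ≤ C * R ^ u)
    (hg : ∀ ε : ℝ, 0 < ε → ∃ C : ℝ, ∀ j, ∀ u : ℕ, |g j (u : ℤ)| ≤ C * ε ^ u) :
    (∑' x : {x : Fin n → ℤ // Monotone x ∧ ∀ i, 0 ≤ x i},
        Matrix.det (Matrix.of fun i j : Fin n =>
            DIter ((List.range ((j : ℕ) + 1)).map fun k => (v k)⁻¹) (f i)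
              (x.1 j + ((j : ℕ) : ℤ))) *
          Matrix.det (Matrix.of fun i j : Fin n =>
            JIter ((List.range ((i : ℕ) + 1)).map v) (g j) (x.1 i + ((i : ℕ) : ℤ)))) =
      Matrix.det (Matrix.of fun i j : Fin n => ∑' u : ℕ, f i (u : ℤ) * g j (u : ℤ)) := by
  classical
  obtain ⟨C, R, hC, hR, hf⟩ := hf
  obtain ⟨ε, hε, -, hRε, hvε⟩ := exists_eps n v hv R hR
  obtain ⟨C', hg⟩ := hg ε hε
  set f' : Fin n → ℤ → ℝ := fun i u => if u < 0 then 0 else f i u with hf'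
  set g' : Fin n → ℤ → ℝ := fun i u => if u < 0 then 0 else g i u with hg'
  have Gf : ∀ i, Grow R (f' i) := fun i =>
    ⟨trunc_decay hC.le hR (f i) (hf i), fun u hu => by simp [hf', hu]⟩
  have Gg : ∀ i, Decay ε (g' i) := fun i =>
    trunc_decay (C := max C' 0) (le_max_right _ _) hε (g i) fun u =>
      (hg i u).trans (by gcongr; exact le_max_left _ _)
  have main := Lev_all hR hε hRε v hvε f' g' Gf Gg
  have hend : Lev v f' g' (fun _ => 0) =
      Matrix.det (Matrix.of fun i j : Fin n => ∑' u : ℕ, f i (u : ℤ) * g j (u : ℤ)) := by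
    have h1 := cauchy_binet hR hε hRε f' g' Gf Gg
    have h2 : Lev v f' g' (fun _ => 0) = SS (fun y => MM (fun _ => f') y * MM (fun _ => g') y) := rfl
    rw [h2, h1]
    congr 1
    ext i j
    simp only [Matrix.of_apply]
    have hinj : Function.Injective (fun n : ℕ => (n : ℤ)) := Nat.cast_injective
    rw [← hinj.tsum_eq (f := fun u => f' i u * g' j u)]
    · exact tsum_congr fun u => by simp [hf', hg', not_lt.2 (Int.natCast_nonneg u)]
    · intro u hu
      by_contra hc
      apply hu
      have : u < 0 := by
        by_contra h0
        exact hc ⟨u.toNat, by simp; omega⟩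
      simp [hf', this]
  rw [← hend, ← main]
  unfold Lev SS
  set s : Set (Fin n → ℤ) := {x | Monotone x ∧ ∀ i, 0 ≤ x i} with hs
  set Φ : (Fin n → ℤ) → ℝ := fun x =>
    Matrix.det (Matrix.of fun i j : Fin n =>
            DIter ((List.range ((j : ℕ) + 1)).map fun k => (v k)⁻¹) (f i)
              (x j + ((j : ℕ) : ℤ))) *
          Matrix.det (Matrix.of fun i j : Fin n =>
            JIter ((List.range ((i : ℕ) + 1)).map v) (g j) (x i + ((i : ℕ) : ℤ))) with hΦ
  have hl : (∑' x : {x : Fin n → ℤ // Monotone x ∧ ∀ i, 0 ≤ x i}, Φ x.1) =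
      ∑' x, s.indicator Φ x := tsum_subtype s Φ
  refine hl.trans ?_
  set c : Fin n → ℤ := fun j => ((j : ℕ) : ℤ) with hc
  refine Eq.trans ?_ ((Equiv.addRight c).tsum_eq _)
  refine tsum_congr fun x => ?_
  have hx : (Equiv.addRight c) x = x + c := rfl
  rw [hx]
  have hms : Monotone x ↔ StrictMono (x + c) := by
    rw [mono_iff, strict_iff]
    refine forall_congr' fun i => forall_congr' fun j => forall_congr' fun hij => ?_
    simp only [Pi.add_apply, hc]
    omega
  by_cases hm : Monotone x
  · rw [if_pos (hms.1 hm)]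
    by_cases h0 : ∀ i, 0 ≤ x i
    · rw [Set.indicator_of_mem (show x ∈ s from ⟨hm, h0⟩)]
      simp only [hΦ]
      congr 1
      · unfold MM
        congr 1
        ext i j
        simp only [Matrix.of_apply, Pi.add_apply, hc]
        refine DIter_congr _ _ ?_ _ _ ?_
        · intro u hu
          by_cases hu0 : u < 0
          · have : u = -1 := by omega
            subst this
            simp [hf', hf0]
          · simp [hf', hu0]
        · have := h0 j
          simp; omega
      · unfold MM
        rw [← Matrix.det_transpose]
        congr 1
        ext i j
        simp only [Matrix.of_apply, Matrix.transpose_apply, Pi.add_apply, hc]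
        refine JIter_congr _ _ ?_ _ _ ?_
        · intro u hu
          simp [hg', not_lt.2 hu]
        · have := h0 j
          omega
    · rw [Set.indicator_of_notMem (fun h : x ∈ s => h0 h.2)]
      push Not at h0
      obtain ⟨i, hi⟩ := h0
      have hn : 0 < n := i.pos
      beta_reduce
      rw [MM_neg _ _ ⟨0, hn⟩, zero_mul]
      · intro i u hu
        exact DIter_neg _ (Gf i).2 _ u hu
      · have : x ⟨0, hn⟩ ≤ x i := hm (Fin.le_def.2 (Nat.zero_le _))
        simp [hc]; omega
  · rw [if_neg (fun h => hm (hms.2 h)), Set.indicator_of_notMem (fun h : x ∈ s => hm h.1)]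
end

section
/- For distinct 0 < v_1,...,v_n < 1 define π(x) = c_n ∏_{k=1}^n v_k^{x_k} · det(D^{(1/v_1,...,1/v_j)} φ_i(x_j + j - 1))_{i,j=1}^n on W^n_{≥0}, where φ_i(x) = v_i^{-(x+1)} - v_i^{x+1} and c_n = ∏_{i<j}(v_i - v_j)^{-1} ∏_j v_j^n. Then Σ_{y ∈ W^n_{≥0}, y_i ≤ η ∀i} π(y) = c_n (∏_k v_k)^η det(D^{(1/v_2,...,1/v_{j-1})} φ_i(η + j - 1))_{i,j=1}^n for every integer η ≥ 0, and this equals ∏_{1≤i≤j≤n}(1 - v_i v_j)(∏_k v_k)^η Sp_{(η,...,η)}(v). -/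
open Finset in
theorem aux_DIter_coeff (N : ℕ) (l : List ℝ) : ∀ m : ℕ, l.length ≤ m → m < N →
    ∃ c : ℕ → ℝ, c m = 1 ∧ (∀ k, m < k → c k = 0) ∧
      ∀ (f : ℤ → ℝ) (u : ℤ), DIter l f (u + m) = ∑ k ∈ range N, f (u + k) * c k := by
  induction l with
  | nil =>
    intro m _ hm
    refine ⟨fun k => if k = m then 1 else 0, by simp, ?_, ?_⟩
    · intro k hk
      simp [hk.ne']
    · intro f u
      simp [DIter, hm]
  | cons a l ih =>
    intro m hl hm
    obtain ⟨m, rfl⟩ : ∃ m', m = m' + 1 := ⟨m - 1, by simp at hl; omega⟩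
    simp only [List.length_cons] at hl
    obtain ⟨c, h1, h2, h3⟩ := ih (m + 1) (by omega) hm
    obtain ⟨d, g1, g2, g3⟩ := ih m (by omega) (by omega)
    refine ⟨fun k => c k - a * d k, by simp [h1, g2], ?_, ?_⟩
    · intro k hk
      simp [h2 k hk, g2 k (by omega)]
    · intro f u
      have e : DIter (a :: l) f (u + ((m + 1 : ℕ) : ℤ)) =
          DIter l f (u + ((m + 1 : ℕ) : ℤ)) - a * DIter l f (u + m) := by
        have : u + ((m + 1 : ℕ) : ℤ) - 1 = u + m := by push_cast; ring
        change DIter l f _ - a * DIter l f (u + ((m + 1 : ℕ) : ℤ) - 1) = _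
        rw [this]
      rw [e, h3, g3, mul_sum, ← sum_sub_distrib]
      exact sum_congr rfl fun k _ => by ring

theorem aux_det_DIter (n : ℕ) (L : ℕ → List ℝ) (hL : ∀ j, (L j).length ≤ j)
    (f : Fin n → ℤ → ℝ) (u : ℤ) :
    Matrix.det (Matrix.of fun i j : Fin n => DIter (L j) (f i) (u + ((j : ℕ) : ℤ))) =
      Matrix.det (Matrix.of fun i j : Fin n => f i (u + ((j : ℕ) : ℤ))) := by
  choose c h1 h2 h3 using fun j : Fin n => aux_DIter_coeff n (L j) j (hL j) j.2
  have hM : (Matrix.of fun i j : Fin n => DIter (L j) (f i) (u + ((j : ℕ) : ℤ))) =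
      (Matrix.of fun i j : Fin n => f i (u + ((j : ℕ) : ℤ))) *
        (Matrix.of fun k j : Fin n => c j k) := by
    ext i j
    simp only [Matrix.of_apply, Matrix.mul_apply]
    rw [h3 j (f i) u, Finset.sum_range]
  rw [hM, Matrix.det_mul, Matrix.det_of_isUpperTriangular (M := Matrix.of fun k j : Fin n => c j k)]
  · simp [h1]
  · intro i j hij
    exact h2 j i hij

theorem aux_DIter_append (l : List ℝ) (a : ℝ) (f : ℤ → ℝ) :
    DIter (l ++ [a]) f = Dop a (DIter l f) := by
  induction l with
  | nil => rfl
  | cons b l ih =>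
    change Dop b (DIter (l ++ [a]) f) = Dop a (Dop b (DIter l f))
    rw [ih]
    funext u
    simp only [Dop]
    ring

/-- the monotone tuples with entries in `[0, η]` and entry `η` from place `m` on -/
def auxT (n : ℕ) (η : ℤ) (m : ℕ) : Set (Fin n → ℤ) :=
  {y | Monotone y ∧ (∀ i, 0 ≤ y i) ∧ (∀ i, y i ≤ η) ∧ ∀ i : Fin n, m ≤ i.1 → y i = η}

theorem auxT_finite (n : ℕ) (η : ℤ) (m : ℕ) : (auxT n η m).Finite := by
  apply (Set.finite_Icc (fun _ : Fin n => (0 : ℤ)) (fun _ => η)).subset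
  intro y hy
  exact ⟨hy.2.1, hy.2.2.1⟩

theorem aux_telescope {E : Type*} [AddCommGroup E] (g : ℤ → E) (a b : ℤ) (h : a ≤ b) :
    ∑ t ∈ Finset.Icc a b, (g t - g (t - 1)) = g b - g (a - 1) := by
  induction b, h using Int.leInduction with
  | base => simp
  | succ k hk ih =>
    have : Finset.Icc a (k + 1) = insert (k + 1) (Finset.Icc a k) := by
      ext x; simp; omega
    rw [this, Finset.sum_insert (by simp), ih]
    simp

open Finset in
theorem aux_step (n : ℕ) (η : ℕ) (A B : Fin n → ℤ → Fin n → ℝ)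
    (hAB : ∀ j t, A j t = B j t - B j (t - 1))
    (hprev : ∀ j k : Fin n, k.1 + 1 = j.1 → ∀ t, ∃ c : ℝ, B j (t - 1) = c • A k t)
    (h0 : ∀ j : Fin n, j.1 = 0 → B j (-1) = 0) (m : ℕ) (hm : m < n) :
    ∑ y ∈ (auxT_finite n η (m + 1)).toFinset,
      Matrix.det (Matrix.of fun j => if j.1 < m + 1 then A j (y j) else B j η) =
    ∑ y ∈ (auxT_finite n η m).toFinset,
      Matrix.det (Matrix.of fun j => if j.1 < m then A j (y j) else B j η) := by
  set p : Fin n := ⟨m, hm⟩ with hp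
  rw [← sum_fiberwise_of_maps_to (s := (auxT_finite n η (m + 1)).toFinset)
    (t := (auxT_finite n η m).toFinset) (g := fun y => Function.update y p (η : ℤ))]
  · apply sum_congr rfl
    intro y hy
    rw [Set.Finite.mem_toFinset] at hy
    obtain ⟨y1, y2, y3, y4⟩ := hy
    obtain ⟨lo, hlo0, hloη, hlo1, hlo2, hlo3⟩ : ∃ lo : ℤ, 0 ≤ lo ∧ lo ≤ η ∧
        (∀ i : Fin n, i.1 < m → y i ≤ lo) ∧
        (∀ t : ℤ, 0 ≤ t → (∀ i : Fin n, i.1 < m → y i ≤ t) → lo ≤ t) ∧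
        (B p (lo - 1) = 0 ∨ ∃ k : Fin n, k.1 + 1 = m ∧ ∃ c : ℝ, B p (lo - 1) = c • A k (y k)) := by
      rcases Nat.eq_zero_or_pos m with h | h
      · refine ⟨0, le_rfl, by positivity, fun i hi => by omega, fun t ht _ => ht, Or.inl ?_⟩
        simpa using h0 p h
      · refine ⟨y ⟨m - 1, by omega⟩, y2 _, y3 _, fun i hi => y1 (Fin.mk_le_mk.2 (by omega)),
          fun t _ ht => ht _ (by simp; omega), Or.inr ⟨⟨m - 1, by omega⟩, by simp; omega, ?_⟩⟩
        exact hprev p _ (by simp [hp]; omega) _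
    set M : Matrix (Fin n) (Fin n) ℝ :=
      Matrix.of fun j => if j.1 < m then A j (y j) else B j η with hM
    have hsum : ∑ t ∈ Icc lo (η : ℤ), (M.updateRow p (A p t)).det = M.det := by
      have e1 : ∀ t, (M.updateRow p (A p t)).det =
          (M.updateRow p (B p t)).det - (M.updateRow p (B p (t - 1))).det := by
        intro t
        have := Matrix.det_updateRow_add M p (A p t) (B p (t - 1))
        rw [hAB p t, sub_add_cancel] at this
        rw [hAB p t, this]; ring
      rw [sum_congr rfl fun t _ => e1 t,
        aux_telescope (fun t => (M.updateRow p (B p t)).det) _ _ hloη]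
      have e2 : M.updateRow p (B p η) = M := by
        have : B p η = M p := by
          change B p η = if p.1 < m then A p (y p) else B p η
          simp [hp]
        rw [this, Matrix.updateRow_eq_self]
      have e3 : (M.updateRow p (B p (lo - 1))).det = 0 := by
        rcases hlo3 with h | ⟨k, hk, c, h⟩
        · rw [h]
          exact Matrix.det_eq_zero_of_row_eq_zero p (by simp)
        · rw [h, Matrix.det_updateRow_smul]
          have hkp : k ≠ p := by
            intro h; rw [h] at hk; simp [hp] at hk
          have : A k (y k) = M k := by
            change A k (y k) = if k.1 < m then A k (y k) else B k η
            rw [if_pos (by omega)]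
          rw [this, Matrix.det_updateRow_eq_zero hkp, mul_zero]
      simp only [e2, e3, sub_zero]
    rw [← hsum]
    symm
    apply sum_nbij (fun t => Function.update y p t)
    · intro t ht
      rw [mem_Icc] at ht
      simp only [mem_filter, Set.Finite.mem_toFinset]
      refine ⟨⟨?_, ?_, ?_, ?_⟩, ?_⟩
      · intro a b hab
        by_cases ha : a = p
        · by_cases hb : b = p
          · rw [ha, hb]
          · have : m ≤ b.1 := by rw [ha] at hab; exact hab
            subst ha
            rw [Function.update_self, Function.update_of_ne hb, y4 b this]
            exact ht.2
        · by_cases hb : b = p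
          · subst hb
            rw [Function.update_self, Function.update_of_ne ha]
            have h1 : a.1 ≤ m := hab
            have h2 : a.1 ≠ m := fun h => ha (Fin.ext h)
            exact (hlo1 a (by omega)).trans ht.1
          · rw [Function.update_of_ne ha, Function.update_of_ne hb]
            exact y1 hab
      · intro i
        by_cases hi : i = p
        · subst hi; rw [Function.update_self]; omega
        · rw [Function.update_of_ne hi]; exact y2 i
      · intro i
        by_cases hi : i = p
        · subst hi; rw [Function.update_self]; omega
        · rw [Function.update_of_ne hi]; exact y3 i
      · intro i hi
        have : i ≠ p := by intro h; rw [h] at hi; simp [hp] at hi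
        rw [Function.update_of_ne this]; exact y4 i (by omega)
      · rw [Function.update_idem]
        have : (η : ℤ) = y p := (y4 p le_rfl).symm
        rw [this, Function.update_eq_self]
    · intro a _ b _ hab
      have := congrFun hab p
      simpa using this
    · intro z hz
      simp only [coe_filter, Set.Finite.mem_toFinset, Set.mem_ofPred_eq] at hz
      obtain ⟨⟨z1, z2, z3, z4⟩, hz⟩ := hz
      have hzy : ∀ i, i ≠ p → y i = z i := by
        intro i hi
        rw [← hz, Function.update_of_ne hi]
      refine ⟨z p, ?_, ?_⟩
      · simp only [coe_Icc, Set.mem_Icc]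
        refine ⟨hlo2 _ (z2 p) ?_, z3 p⟩
        intro i hi
        rw [hzy i (by intro h; rw [h] at hi; simp [hp] at hi)]
        exact z1 (Fin.le_def.2 (by simp [hp]; omega))
      · funext i
        by_cases hi : i = p
        · subst hi; simp
        · simp [Function.update_of_ne hi, hzy i hi]
    · intro t _
      congr 1
      ext i j
      by_cases hi : i = p
      · subst hi
        simp [hp]
      · have h2 : i.1 ≠ m := fun h => hi (Fin.ext h)
        have h3 : (i.1 < m + 1) ↔ i.1 < m := by omega
        simp only [Matrix.updateRow_ne hi, hM, Matrix.of_apply, Function.update_of_ne hi, h3]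
  · intro y hy
    rw [Set.Finite.mem_toFinset] at hy ⊢
    obtain ⟨y1, y2, y3, y4⟩ := hy
    refine ⟨?_, ?_, ?_, ?_⟩
    · intro a b hab
      by_cases hb : b = p
      · subst hb
        simp only [Function.update_self]
        by_cases ha : a = p
        · subst ha; simp
        · rw [Function.update_of_ne ha]; exact y3 a
      · by_cases ha : a = p
        · have h1 : m ≤ b.1 := by rw [ha] at hab; exact hab
          have h2 : b.1 ≠ m := fun h => hb (Fin.ext h)
          simp only [Function.update_of_ne hb]
          subst ha
          rw [Function.update_self, y4 b (by omega)]
        · simp only [Function.update_of_ne ha, Function.update_of_ne hb]; exact y1 hab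
    · intro i
      by_cases hi : i = p
      · subst hi; simp
      · simp only [Function.update_of_ne hi]; exact y2 i
    · intro i
      by_cases hi : i = p
      · subst hi; simp
      · simp only [Function.update_of_ne hi]; exact y3 i
    · intro i h
      by_cases hi : i = p
      · subst hi; simp
      · have h2 : i.1 ≠ m := fun h => hi (Fin.ext h)
        simp only [Function.update_of_ne hi]; exact y4 i (by omega)

theorem aux_sum (n : ℕ) (η : ℕ) (A B : Fin n → ℤ → Fin n → ℝ)
    (hAB : ∀ j t, A j t = B j t - B j (t - 1))
    (hprev : ∀ j k : Fin n, k.1 + 1 = j.1 → ∀ t, ∃ c : ℝ, B j (t - 1) = c • A k t)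
    (h0 : ∀ j : Fin n, j.1 = 0 → B j (-1) = 0) :
    ∑ y ∈ (auxT_finite n η n).toFinset, Matrix.det (Matrix.of fun j => A j (y j)) =
      Matrix.det (Matrix.of fun j => B j η) := by
  have key : ∀ m ≤ n, ∑ y ∈ (auxT_finite n η m).toFinset,
      Matrix.det (Matrix.of fun j => if j.1 < m then A j (y j) else B j η) =
      Matrix.det (Matrix.of fun j => B j η) := by
    intro m
    induction m with
    | zero =>
      intro _
      have : (auxT_finite n η 0).toFinset = {fun _ => (η : ℤ)} := by
        ext y
        simp only [Set.Finite.mem_toFinset, Finset.mem_singleton]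
        constructor
        · intro h; funext i; exact h.2.2.2 i (Nat.zero_le _)
        · rintro rfl
          exact ⟨monotone_const, fun _ => by positivity, fun _ => le_rfl, fun _ _ => rfl⟩
      rw [this]; simp
    | succ m ih =>
      intro h
      rw [aux_step n η A B hAB hprev h0 m h, ih (by omega)]
  rw [← key n le_rfl]
  simp

/-- monic polynomials expressing `(v^(j+1) - v^-(j+1)) / (v - v^-1)` in `v + v^-1` -/
noncomputable def auxU : ℕ → Polynomial ℝ
  | 0 => 1
  | 1 => Polynomial.X
  | (k + 2) => Polynomial.X * auxU (k + 1) - auxU k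

theorem auxU_spec (k : ℕ) : (auxU k).Monic ∧ (auxU k).natDegree = k := by
  induction k using Nat.strong_induction_on with
  | _ k ih =>
    match k with
    | 0 => simp [auxU]
    | 1 => simp [auxU]
    | (k + 2) =>
      obtain ⟨h1, h2⟩ := ih (k + 1) (by omega)
      obtain ⟨g1, g2⟩ := ih k (by omega)
      have hm : (Polynomial.X * auxU (k + 1)).Monic := Polynomial.monic_X.mul h1
      have hd : (Polynomial.X * auxU (k + 1)).natDegree = k + 2 := by
        rw [Polynomial.monic_X.natDegree_mul h1, h2, Polynomial.natDegree_X]; ring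
      have hlt : (auxU k).natDegree < (Polynomial.X * auxU (k + 1)).natDegree := by omega
      rw [auxU]
      refine ⟨hm.sub_of_left (Polynomial.degree_lt_degree hlt), ?_⟩
      rw [Polynomial.natDegree_sub_eq_left_of_natDegree_lt hlt, hd]

theorem auxU_eval (x : ℝ) (hx : x ≠ 0) (k : ℕ) :
    (x - x⁻¹) * (auxU k).eval (x + x⁻¹) = x ^ ((k : ℤ) + 1) - x ^ (-((k : ℤ) + 1)) := by
  have key : ∀ k : ℕ, (x - x⁻¹) * (auxU k).eval (x + x⁻¹) = x ^ (k + 1) - (x⁻¹) ^ (k + 1) := by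
    intro k
    induction k using Nat.strong_induction_on with
    | _ k ih =>
      match k with
      | 0 => simp [auxU]
      | 1 => simp [auxU]; ring
      | (k + 2) =>
        have h1 := ih (k + 1) (by omega)
        have h2 := ih k (by omega)
        rw [auxU]
        simp only [Polynomial.eval_sub, Polynomial.eval_mul, Polynomial.eval_X]
        have hxx : x * x⁻¹ = 1 := mul_inv_cancel₀ hx
        generalize x⁻¹ = w at *
        linear_combination (x + w) * h1 - h2 + (x ^ (k + 1) - w ^ (k + 1)) * hxx
  rw [key k, zpow_neg, inv_pow]
  norm_cast

theorem aux_prod (n : ℕ) (P : ℕ → ℕ → ℝ) :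
    ∏ i ∈ Finset.range n, ∏ j ∈ (Finset.range n).filter (fun j => i < j), P i j =
      ∏ i : Fin n, ∏ j ∈ Finset.Ioi i, P i j := by
  rw [Finset.prod_range]
  apply Finset.prod_congr rfl
  intro i _
  symm
  apply Finset.prod_nbij (fun j : Fin n => j.1)
  · intro j hj; simpa using hj
  · intro a _ b _ h; exact Fin.ext h
  · intro j hj
    simp at hj
    exact ⟨⟨j, hj.1⟩, by simpa [Fin.lt_def] using hj.2, rfl⟩
  · intro _ _; rfl

theorem aux_prod_pow (n : ℕ) (f : Fin n → ℝ) :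
    (∏ i, ∏ j ∈ Finset.Ioi i, f i * f j) * ∏ i, f i = ∏ i, f i ^ n := by
  induction n with
  | zero => simp
  | succ n ih =>
    have := ih (fun i => f i.succ)
    simp only [Fin.prod_univ_succ, Fin.prod_Ioi_zero, Fin.prod_Ioi_succ, pow_succ,
      Finset.prod_mul_distrib] at this ⊢
    rw [← this]
    simp only [Finset.prod_const, Finset.card_univ, Fintype.card_fin]
    ring

theorem aux_weyl (n : ℕ) (v : ℕ → ℝ) (hv : ∀ i < n, v i ≠ 0) :
    Matrix.det (Matrix.of fun a b : Fin n =>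
            v (a : ℕ) ^ ((b : ℤ) + 1) - v (a : ℕ) ^ (-((b : ℤ) + 1))) *
      ∏ j ∈ Finset.range n, v j ^ n =
    (-1) ^ n * (∏ i ∈ Finset.range n,
        ∏ j ∈ (Finset.range n).filter (fun j => i ≤ j), (1 - v i * v j)) *
      ∏ i ∈ Finset.range n, ∏ j ∈ (Finset.range n).filter (fun j => i < j), (v i - v j) := by
  have hM : (Matrix.of fun a b : Fin n =>
      v (a : ℕ) ^ ((b : ℤ) + 1) - v (a : ℕ) ^ (-((b : ℤ) + 1))) =
      Matrix.of fun a b : Fin n => (v a - (v a)⁻¹) *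
        (Matrix.of fun a b : Fin n => (auxU b).eval (v a + (v a)⁻¹)) a b := by
    ext a b
    simp only [Matrix.of_apply]
    rw [auxU_eval _ (hv a a.2)]
  have hfil : ∀ i ∈ Finset.range n, (Finset.range n).filter (fun j => i ≤ j) =
      insert i ((Finset.range n).filter (fun j => i < j)) := by
    intro i hi
    ext j
    simp at hi ⊢
    omega
  have hle : (∏ i ∈ Finset.range n,
        ∏ j ∈ (Finset.range n).filter (fun j => i ≤ j), (1 - v i * v j)) =
      (∏ i : Fin n, (1 - v i * v i)) * ∏ i : Fin n, ∏ j ∈ Finset.Ioi i, (1 - v i * v j) := by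
    rw [← aux_prod n (fun i j => 1 - v i * v j), Finset.prod_range (n := n) (f := fun i => ∏ j ∈ (Finset.range n).filter (fun j => i < j), (1 - v i * v j)), ← Finset.prod_mul_distrib,
      Finset.prod_range]
    apply Finset.prod_congr rfl
    intro i _
    rw [hfil i (by simp), Finset.prod_insert (by simp)]
  rw [hM, Matrix.det_mul_column, ← Matrix.det_eval_matrixOfPolynomials_eq_det_vandermonde
    (fun a : Fin n => v a + (v a)⁻¹) (fun b => auxU b) (fun b => (auxU_spec b).2)
    (fun b => (auxU_spec b).1), Matrix.det_vandermonde, hle, aux_prod n (fun i j => v i - v j),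
    Finset.prod_range, ← aux_prod_pow n (fun i => v i)]
  have e1 : (∏ i : Fin n, ∏ j ∈ Finset.Ioi i, ((v j + (v j)⁻¹) - (v i + (v i)⁻¹))) *
      (∏ i : Fin n, ∏ j ∈ Finset.Ioi i, v i * v j) =
      (∏ i : Fin n, ∏ j ∈ Finset.Ioi i, (1 - v i * v j)) *
        ∏ i : Fin n, ∏ j ∈ Finset.Ioi i, (v i - v j) := by
    simp only [← Finset.prod_mul_distrib (s := Finset.univ)]
    apply Finset.prod_congr rfl
    intro i _
    rw [← Finset.prod_mul_distrib, ← Finset.prod_mul_distrib]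
    apply Finset.prod_congr rfl
    intro j _
    have hi := hv i i.2
    have hj := hv j j.2
    field_simp
    ring
  have e2 : (∏ i : Fin n, (v i - (v i)⁻¹)) * (∏ i : Fin n, v i) =
      (-1) ^ n * ∏ i : Fin n, (1 - v i * v i) := by
    have h1 : (-1 : ℝ) ^ n = ∏ i : Fin n, (-1) := by simp
    rw [h1, ← Finset.prod_mul_distrib, ← Finset.prod_mul_distrib]
    apply Finset.prod_congr rfl
    intro i _
    have hi := hv i i.2
    field_simp
    ring
  linear_combination ((∏ i : Fin n, (v i - (v i)⁻¹)) * (∏ i : Fin n, v i)) * e1 +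
    ((∏ i : Fin n, ∏ j ∈ Finset.Ioi i, (1 - v i * v j)) *
        ∏ i : Fin n, ∏ j ∈ Finset.Ioi i, (v i - v j)) * e2

theorem aux_tsum (n η : ℕ) (F : (Fin n → ℤ) → ℝ) :
    ∑' y : {y : Fin n → ℤ // Monotone y ∧ (∀ i, 0 ≤ y i) ∧ ∀ i, y i ≤ (η : ℤ)}, F y.1 =
      ∑ y ∈ (auxT_finite n η n).toFinset, F y := by
  rw [← Finset.tsum_subtype]
  have h : ∀ y : Fin n → ℤ, (Monotone y ∧ (∀ i, 0 ≤ y i) ∧ ∀ i, y i ≤ (η : ℤ)) ↔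
      y ∈ (auxT_finite n η n).toFinset := by
    intro y
    rw [Set.Finite.mem_toFinset]
    exact ⟨fun h => ⟨h.1, h.2.1, h.2.2, fun i hi => absurd i.2 (by omega)⟩,
      fun h => ⟨h.1, h.2.1, h.2.2.1⟩⟩
  exact (Equiv.subtypeEquivRight h).tsum_eq
    (fun y : {y // y ∈ (auxT_finite n η n).toFinset} => F y.1)

theorem aux_part1 (n : ℕ) (v : ℕ → ℝ) (hv : ∀ i < n, v i ≠ 0) (η : ℕ) :
    ∑ y ∈ (auxT_finite n η n).toFinset,
      ((∏ k : Fin n, v k ^ (y k)) *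
            Matrix.det (Matrix.of fun i j : Fin n =>
              DIter ((List.range ((j : ℕ) + 1)).map fun k => (v k)⁻¹)
                (fun u => v (i : ℕ) ^ (-(u + 1)) - v (i : ℕ) ^ (u + 1))
                (y j + ((j : ℕ) : ℤ)))) =
      (∏ k ∈ Finset.range n, v k) ^ η *
        Matrix.det (Matrix.of fun i j : Fin n =>
              v (i : ℕ) ^ (-((η + ((j : ℕ) : ℤ)) + 1)) -
                v (i : ℕ) ^ ((η + ((j : ℕ) : ℤ)) + 1)) := by
  set φ : Fin n → ℤ → ℝ := fun i u => v (i : ℕ) ^ (-(u + 1)) - v (i : ℕ) ^ (u + 1) with hφ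
  have hdet := aux_det_DIter n (fun j => (List.range j).map fun k => (v k)⁻¹)
    (fun j => by simp) φ η
  have key := aux_sum n η
    (fun j t i => v j ^ t * DIter ((List.range ((j : ℕ) + 1)).map fun k => (v k)⁻¹) (φ i)
      (t + ((j : ℕ) : ℤ)))
    (fun j t i => v j ^ t * DIter ((List.range (j : ℕ)).map fun k => (v k)⁻¹) (φ i)
      (t + ((j : ℕ) : ℤ))) ?_ ?_ ?_
  · rw [hφ] at hdet
    rw [← hdet, Finset.prod_range, ← Finset.prod_pow]
    rw [← hφ]
    have hA : ∀ (y : Fin n → ℤ) (L : ℕ → List ℝ), Matrix.det (Matrix.of fun j i : Fin n =>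
        v j ^ (y j) * DIter (L j) (φ i) (y j + ((j : ℕ) : ℤ))) =
        (∏ k : Fin n, v k ^ (y k)) * Matrix.det (Matrix.of fun i j : Fin n =>
          DIter (L j) (φ i) (y j + ((j : ℕ) : ℤ))) := by
      intro y L
      rw [← Matrix.det_mul_row, ← Matrix.det_transpose]
      rfl
    have hB := hA (fun _ => (η : ℤ)) (fun j => (List.range j).map fun k => (v k)⁻¹)
    simp only [zpow_natCast] at hB
    rw [← hB]
    simp only [zpow_natCast] at key
    rw [← key]
    apply Finset.sum_congr rfl
    intro y _
    exact (hA y (fun j => (List.range (j + 1)).map fun k => (v k)⁻¹)).symm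
  · intro j t
    funext i
    have hj := hv j j.2
    simp only [List.range_succ, List.map_append, List.map_cons, List.map_nil, aux_DIter_append,
      Dop, Pi.sub_apply]
    rw [zpow_sub_one₀ hj, show t - 1 + ((j : ℕ) : ℤ) = t + ((j : ℕ) : ℤ) - 1 by ring]
    ring
  · intro j k hjk t
    have hk := zpow_ne_zero t (hv k k.2)
    refine ⟨v j ^ (t - 1) / v k ^ t, ?_⟩
    funext i
    simp only [Pi.smul_apply, smul_eq_mul, ← hjk]
    rw [show t - 1 + ((k.1 + 1 : ℕ) : ℤ) = t + ((k : ℕ) : ℤ) by push_cast; ring]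
    field_simp
  · intro j hj
    funext i
    simp [hj, DIter, hφ]

/-- For distinct `0 < v 0, ..., v (n-1) < 1` (here `v k` stands for `v_{k+1}`), with
`φ_i(x) = v_i^{-(x+1)} - v_i^{x+1}`, `c_n = ∏_{i<j}(v_i - v_j)⁻¹ ∏_j v_j^n`, and
`π(x) = c_n ∏_k v_k^{x_k} det(D^{(1/v_1,...,1/v_j)} φ_i(x_j + j - 1))` on
`W^n_{≥0} = {0 ≤ x_1 ≤ ... ≤ x_n}`: for every `η ≥ 0`,
`Σ_{y ∈ W^n_{≥0}, y_i ≤ η} π(y) = c_n (∏ v_k)^η det(D^{(1/v_2,...,1/v_{j-1})} φ_i(η + j - 1))`,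
and this equals `∏_{i≤j}(1 - v_i v_j) (∏ v_k)^η Sp_{(η,...,η)}(v)` where
`Sp_x(v) = det(v_i^{x_j+j} - v_i^{-(x_j+j)}) / det(v_i^j - v_i^{-j})`. -/
theorem stmt8 (n : ℕ) (v : ℕ → ℝ) (hv : ∀ i < n, 0 < v i ∧ v i < 1)
    (hdist : ∀ i < n, ∀ j < n, i ≠ j → v i ≠ v j) (η : ℕ) :
    (∑' y : {y : Fin n → ℤ // Monotone y ∧ (∀ i, 0 ≤ y i) ∧ ∀ i, y i ≤ (η : ℤ)},
        ((∏ i ∈ Finset.range n, ∏ j ∈ (Finset.range n).filter (fun j => i < j), (v i - v j))⁻¹ *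
            ∏ j ∈ Finset.range n, v j ^ n) *
          ((∏ k : Fin n, v k ^ (y.1 k)) *
            Matrix.det (Matrix.of fun i j : Fin n =>
              DIter ((List.range ((j : ℕ) + 1)).map fun k => (v k)⁻¹)
                (fun u => v (i : ℕ) ^ (-(u + 1)) - v (i : ℕ) ^ (u + 1))
                (y.1 j + ((j : ℕ) : ℤ))))) =
      ((∏ i ∈ Finset.range n, ∏ j ∈ (Finset.range n).filter (fun j => i < j), (v i - v j))⁻¹ *
          ∏ j ∈ Finset.range n, v j ^ n) *
        ((∏ k ∈ Finset.range n, v k) ^ η *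
          Matrix.det (Matrix.of fun i j : Fin n =>
            DIter ((List.range ((j : ℕ) - 1)).map fun k => (v (k + 1))⁻¹)
              (fun u => v (i : ℕ) ^ (-(u + 1)) - v (i : ℕ) ^ (u + 1))
              ((η : ℤ) + ((j : ℕ) : ℤ)))) ∧
    ((∏ i ∈ Finset.range n, ∏ j ∈ (Finset.range n).filter (fun j => i < j), (v i - v j))⁻¹ *
          ∏ j ∈ Finset.range n, v j ^ n) *
        ((∏ k ∈ Finset.range n, v k) ^ η *
          Matrix.det (Matrix.of fun i j : Fin n =>
            DIter ((List.range ((j : ℕ) - 1)).map fun k => (v (k + 1))⁻¹)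
              (fun u => v (i : ℕ) ^ (-(u + 1)) - v (i : ℕ) ^ (u + 1))
              ((η : ℤ) + ((j : ℕ) : ℤ)))) =
      (∏ i ∈ Finset.range n, ∏ j ∈ (Finset.range n).filter (fun j => i ≤ j), (1 - v i * v j)) *
        (∏ k ∈ Finset.range n, v k) ^ η *
        (Matrix.det (Matrix.of fun a b : Fin n =>
            v (a : ℕ) ^ ((η : ℤ) + (b : ℤ) + 1) - v (a : ℕ) ^ (-((η : ℤ) + (b : ℤ) + 1))) /
          Matrix.det (Matrix.of fun a b : Fin n =>
            v (a : ℕ) ^ ((b : ℤ) + 1) - v (a : ℕ) ^ (-((b : ℤ) + 1)))) := by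
  
  have hne : ∀ i < n, v i ≠ 0 := fun i hi => (hv i hi).1.ne'
  have hdet := aux_det_DIter n (fun j => (List.range (j - 1)).map fun k => (v (k + 1))⁻¹)
    (fun j => by simp) (fun i u => v (i : ℕ) ^ (-(u + 1)) - v (i : ℕ) ^ (u + 1)) η
  rw [hdet]
  constructor
  · rw [← aux_part1 n v hne η, Finset.mul_sum]
    exact aux_tsum n η (fun y => ((∏ i ∈ Finset.range n,
        ∏ j ∈ (Finset.range n).filter (fun j => i < j), (v i - v j))⁻¹ *
            ∏ j ∈ Finset.range n, v j ^ n) *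
          ((∏ k : Fin n, v k ^ (y k)) *
            Matrix.det (Matrix.of fun i j : Fin n =>
              DIter ((List.range ((j : ℕ) + 1)).map fun k => (v k)⁻¹)
                (fun u => v (i : ℕ) ^ (-(u + 1)) - v (i : ℕ) ^ (u + 1))
                (y j + ((j : ℕ) : ℤ)))))
  · have hw := aux_weyl n v hne
    set W := Matrix.det (Matrix.of fun a b : Fin n =>
            v (a : ℕ) ^ ((b : ℤ) + 1) - v (a : ℕ) ^ (-((b : ℤ) + 1)))
    have hneg : Matrix.det (Matrix.of fun a b : Fin n =>
            v (a : ℕ) ^ ((η : ℤ) + (b : ℤ) + 1) - v (a : ℕ) ^ (-((η : ℤ) + (b : ℤ) + 1))) =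
        (-1) ^ n * Matrix.det (Matrix.of fun i j : Fin n =>
              v (i : ℕ) ^ (-((η + ((j : ℕ) : ℤ)) + 1)) -
                v (i : ℕ) ^ ((η + ((j : ℕ) : ℤ)) + 1)) := by
      have h := Matrix.det_neg (Matrix.of fun i j : Fin n =>
              v (i : ℕ) ^ (-((η + ((j : ℕ) : ℤ)) + 1)) -
                v (i : ℕ) ^ ((η + ((j : ℕ) : ℤ)) + 1))
      rw [Fintype.card_fin] at h
      rw [← h]
      congr 1
      ext a b
      simp
    rw [hneg]
    have hV : (∏ i ∈ Finset.range n, ∏ j ∈ (Finset.range n).filter (fun j => i < j),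
        (v i - v j)) ≠ 0 := by
      refine Finset.prod_ne_zero_iff.2 fun i hi => Finset.prod_ne_zero_iff.2 fun j hj => ?_
      simp only [Finset.mem_filter, Finset.mem_range] at hi hj
      exact sub_ne_zero.2 (hdist i hi j hj.1 hj.2.ne)
    have hP : (∏ i ∈ Finset.range n, ∏ j ∈ (Finset.range n).filter (fun j => i ≤ j),
        (1 - v i * v j)) ≠ 0 := by
      refine Finset.prod_ne_zero_iff.2 fun i hi => Finset.prod_ne_zero_iff.2 fun j hj => ?_
      simp only [Finset.mem_filter, Finset.mem_range] at hi hj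
      have h1 := hv i hi
      have h2 := hv j hj.1
      have : v i * v j < 1 := by nlinarith
      linarith
    have hs : ((-1 : ℝ) ^ n) * (-1) ^ n = 1 := by
      rw [← mul_pow]; simp
    have hs0 : ((-1 : ℝ) ^ n) ≠ 0 := by simp
    have hW : W ≠ 0 := by
      intro h
      rw [h, zero_mul] at hw
      exact mul_ne_zero (mul_ne_zero hs0 hP) hV hw.symm
    generalize (∏ i ∈ Finset.range n, ∏ j ∈ (Finset.range n).filter (fun j => i < j),
        (v i - v j)) = V at *
    generalize (∏ i ∈ Finset.range n, ∏ j ∈ (Finset.range n).filter (fun j => i ≤ j),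
        (1 - v i * v j)) = P at *
    generalize (∏ j ∈ Finset.range n, v j ^ n) = R at *
    generalize (-1 : ℝ) ^ n = s at *
    generalize (∏ k ∈ Finset.range n, v k) ^ η = q at *
    generalize Matrix.det (Matrix.of fun i j : Fin n =>
              v (i : ℕ) ^ (-((η + ((j : ℕ) : ℤ)) + 1)) -
                v (i : ℕ) ^ ((η + ((j : ℕ) : ℤ)) + 1)) = Δ at *
    have : V⁻¹ * R = P * s / W := by
      field_simp
      linear_combination hw
    rw [this]
    ring
end
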